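/- arXiv:1306.5862 — 3 statements merged into one kernel-verified Lean document; each statement's English description precedes it below -/
import Mathlib

section
/- Let a, b, p be real numbers with a > 0, p > 0 and f(p) := a·b − p·(a − 2) > 0, and set f(2) := a·b − 2·(a − 2). Then the inequality 3·(p·f(2)/f(p)) ≤ 2·(a·b·p/f(p)) holds if and only if b ≤ 6·(1 − 2/a); moreover equality holds in the first inequality if and only if b = 6·(1 − 2/a). -/
theorem stmt_0 (a b p : ℝ) (ha : a > 0) (hp : p > 0)
    (fp f2 : ℝ) (hfp : fp = a * b - p * (a - 2)) (hf2 : f2 = a * b - 2 * (a - 2))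
    (hfppos : fp > 0) :
    (3 * (p * f2 / fp) ≤ 2 * (a * b * p / fp) ↔ b ≤ 6 * (1 - 2 / a)) ∧
    (3 * (p * f2 / fp) = 2 * (a * b * p / fp) ↔ b = 6 * (1 - 2 / a)) := by
  have hc : 0 < p * a / fp := by positivity
  have key : 3 * (p * f2 / fp) - 2 * (a * b * p / fp) =
      p * a / fp * (b - 6 * (1 - 2 / a)) := by
    rw [hf2]
    field_simp
    ring
  constructor
  · rw [← sub_nonpos, key, ← mul_zero (p * a / fp), mul_le_mul_iff_right₀ hc, sub_nonpos]
  · rw [← sub_eq_zero, key, mul_eq_zero_iff_left hc.ne', sub_eq_zero]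
end

section
/- Let λ₁, λ₂ be positive reals, let a₁, a₂, b₁, b₂ be reals with a₁ > 0, a₂ > 0 and a₁ ≠ a₂, and let α ∈ (0,1). Set λE₁ := λ₁·a₁/2, λE₂ := λ₂·a₂/2, and define the mixture values a := (α·λ₁·a₁ + (1−α)·λ₂·a₂)/(α·λ₁ + (1−α)·λ₂) and b := (α·λE₁·b₁ + (1−α)·λE₂·b₂)/(α·λE₁ + (1−α)·λE₂). Then a ≠ 0 and b = (b₁·a₁ − b₂·a₂)/(a₁ − a₂) − (b₁ − b₂)·a₁·a₂/(a·(a₁ − a₂)). -/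
theorem stmt_5 (lam1 lam2 a1 a2 b1 b2 al : ℝ)
    (hlam1 : lam1 > 0) (hlam2 : lam2 > 0)
    (ha1 : a1 > 0) (ha2 : a2 > 0) (hne : a1 ≠ a2)
    (hal : al ∈ Set.Ioo (0 : ℝ) 1)
    (lE1 lE2 a b : ℝ)
    (hlE1 : lE1 = lam1 * a1 / 2) (hlE2 : lE2 = lam2 * a2 / 2)
    (ha : a = (al * lam1 * a1 + (1 - al) * lam2 * a2) / (al * lam1 + (1 - al) * lam2))
    (hb : b = (al * lE1 * b1 + (1 - al) * lE2 * b2) / (al * lE1 + (1 - al) * lE2)) :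
    a ≠ 0 ∧
    b = (b1 * a1 - b2 * a2) / (a1 - a2) - (b1 - b2) * a1 * a2 / (a * (a1 - a2)) := by
  obtain ⟨h0, h1⟩ := hal
  have hp : 0 < al * lam1 := mul_pos h0 hlam1
  have hq : 0 < (1 - al) * lam2 := mul_pos (sub_pos.mpr h1) hlam2
  have hb' : b = (al * lam1 * a1 * b1 + (1 - al) * lam2 * a2 * b2) /
      (al * lam1 * a1 + (1 - al) * lam2 * a2) := by
    rw [hb, hlE1, hlE2, ← mul_div_mul_left _ _ (two_ne_zero (α := ℝ))]
    congr 1 <;> ring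
  clear hb
  generalize al * lam1 = p at *
  generalize (1 - al) * lam2 = q at *
  have hN : 0 < p * a1 + q * a2 := by positivity
  have hD : 0 < p + q := by positivity
  have hsub : a1 - a2 ≠ 0 := sub_ne_zero.mpr hne
  have ha0 : a ≠ 0 := by
    rw [ha]
    positivity
  refine ⟨ha0, ?_⟩
  have haD : a * (p + q) = p * a1 + q * a2 := by
    rw [ha, div_mul_cancel₀ _ hD.ne']
  rw [hb', div_sub_div _ _ hsub (mul_ne_zero ha0 hsub),
    div_eq_div_iff hN.ne' (mul_ne_zero hsub (mul_ne_zero ha0 hsub))]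
  linear_combination -(a1 - a2) * (b1 - b2) * a1 * a2 * haD
end

section
/- Let a, b, p be real numbers with a ≥ 4, b ≥ 3, p < a·b/(a − 2), and such that either (b < 6·(1 − 2/a) and p ≥ 3) or (b ≥ 6·(1 − 2/a) and p > a·b/(2·(a − 2))). Define R1 := a − 2 + (a·b/2)·(1 − 4/p) and R2 := a/4 + (a·b/2)·(1 − 3/p). Then there exist real numbers ψ and τ such that 0 ≤ ψ ≤ min(R1, R2), 0 ≤ τ, τ ≤ ψ, ψ − a/2 ≤ τ, ψ/2 + (a/4)·(b − 6·(1 − 2/a)) ≤ τ, and τ ≤ (a·b/2)·(1 − 3/p). -/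
theorem stmt_19 (a b p : ℝ) (ha : a ≥ 4) (hb : b ≥ 3)
    (hpu : p < a * b / (a - 2))
    (hcase : (b < 6 * (1 - 2 / a) ∧ p ≥ 3) ∨
             (b ≥ 6 * (1 - 2 / a) ∧ p > a * b / (2 * (a - 2))))
    (R1 R2 : ℝ)
    (hR1 : R1 = a - 2 + (a * b / 2) * (1 - 4 / p))
    (hR2 : R2 = a / 4 + (a * b / 2) * (1 - 3 / p)) :
    ∃ psi tau : ℝ,
      0 ≤ psi ∧ psi ≤ min R1 R2 ∧
      0 ≤ tau ∧ tau ≤ psi ∧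
      psi - a / 2 ≤ tau ∧
      psi / 2 + (a / 4) * (b - 6 * (1 - 2 / a)) ≤ tau ∧
      tau ≤ (a * b / 2) * (1 - 3 / p) := by
  have ha2 : 0 < a - 2 := by linarith
  have hab : 0 < a * b := by nlinarith
  have hp : 0 < p := by
    rcases hcase with ⟨-, h⟩ | ⟨-, h⟩
    · linarith
    · exact lt_trans (by positivity) h
  have hT : a * b / 2 * (1 - 3 / p) = a * b / 2 - 3 / 2 * (a * b / p) := by ring
  have hU : a * b / 2 * (1 - 4 / p) = a * b / 2 - 2 * (a * b / p) := by ring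
  have hK : a / 4 * (b - 6 * (1 - 2 / a)) = (a * b - 6 * (a - 2)) / 4 := by
    field_simp
  rw [hU] at hR1
  rw [hT] at hR2 ⊢
  rw [hK]
  rcases hcase with ⟨hb6, hp3⟩ | ⟨hb6, hpl⟩
  · have hs : a * b / p ≤ a * b / 3 := by gcongr
    have hneg : a / 4 * (b - 6 * (1 - 2 / a)) < 0 :=
      mul_neg_of_pos_of_neg (by linarith) (by linarith)
    rw [hK] at hneg
    exact ⟨0, 0, le_rfl, le_min (by linarith) (by linarith), le_rfl, le_rfl,
      by linarith, by linarith, by linarith⟩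
  · have hs : a * b / p < 2 * (a - 2) := by
      rw [gt_iff_lt, div_lt_iff₀ (by linarith)] at hpl
      rw [div_lt_iff₀ hp]
      linarith
    have hnonneg : 0 ≤ a / 4 * (b - 6 * (1 - 2 / a)) :=
      mul_nonneg (by linarith) (by linarith)
    rw [hK] at hnonneg
    exact ⟨(a * b - 6 * (a - 2)) / 2, (a * b - 6 * (a - 2)) / 2, by linarith,
      le_min (by linarith) (by linarith), by linarith, le_rfl,
      by linarith, by linarith, by linarith⟩
end
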